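/- arXiv:2202.00629 — 3 statements merged into one kernel-verified Lean document; each statement's English description precedes it below -/
import Mathlib

section
/- Let d ≥ 1, a ∈ ℝ^d, Σ_X, Σ_Y positive definite d×d matrices, Σ_S := Σ_X + Σ_Y, and L₁, L₂ probability measures on ℝ. Let L₃ be the law of V₂ − V₁ for independent V₁ ∼ L₁, V₂ ∼ L₂. Define the model densities p(x|θ) = ∫ φ_d(x − θ − v₁a; Σ_X) dL₁(v₁), q(y|θ) = ∫ φ_d(y − θ − v₂a; Σ_Y) dL₂(v₂), the predictive density q̂_U(y; x) = ∫ φ_d(y − x − ua; Σ_S) dL₃(u), and the univariate densities g_S(t) = ∫ φ(t − u√(aᵀΣ_S⁻¹a)) dL₃(u) and g_Y(t) = ∫ φ(t − v√(aᵀΣ_Y⁻¹a)) dL₂(v). Assume g_S log g_S and g_Y log g_Y are integrable and that the KL risk of q̂_U is well defined. Then for every θ ∈ ℝ^d: R(θ, q̂_U) = H(g_S) − H(g_Y) + (1/2) log(det Σ_S / det Σ_Y); in particular the KL risk of q̂_U is constant in θ. -/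
open MeasureTheory Matrix Real

/-- The centered `d`-variate normal density `φ_d(z; Σ)` with covariance matrix `S`. -/
noncomputable def mvn (d : ℕ) (S : Matrix (Fin d) (Fin d) ℝ) (z : Fin d → ℝ) : ℝ :=
  (2 * π) ^ (-(d : ℝ) / 2) * S.det ^ (-(1 : ℝ) / 2) * Real.exp (-(z ⬝ᵥ S⁻¹ *ᵥ z) / 2)

/-- The standard normal density `φ` on `ℝ`. -/
noncomputable def stdphi (t : ℝ) : ℝ := Real.exp (-(t ^ 2) / 2) / Real.sqrt (2 * π)

lemma stdphi_eq_gaussianPDFReal : stdphi = ProbabilityTheory.gaussianPDFReal 0 1 := by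
  ext t
  simp [stdphi, ProbabilityTheory.gaussianPDFReal, div_eq_inv_mul]

lemma stdphi_pos (t : ℝ) : 0 < stdphi t := by
  unfold stdphi; positivity

lemma continuous_stdphi : Continuous stdphi := by
  unfold stdphi; fun_prop

lemma integrable_stdphi : Integrable stdphi := by
  rw [stdphi_eq_gaussianPDFReal]
  exact ProbabilityTheory.integrable_gaussianPDFReal 0 1

lemma integral_stdphi : ∫ t, stdphi t = 1 := by
  rw [stdphi_eq_gaussianPDFReal]
  exact ProbabilityTheory.integral_gaussianPDFReal_eq_one 0 one_ne_zero

lemma integrable_stdphi_mul_log : Integrable (fun t => stdphi t * Real.log (stdphi t)) := by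
  have hsq : Integrable (fun t : ℝ => t ^ 2 * Real.exp (-(1 / 2) * t ^ 2)) := by
    simpa using integrable_rpow_mul_exp_neg_mul_sq (b := 1 / 2) (by norm_num) (s := 2)
      (by norm_num)
  refine ((hsq.const_mul (-(1 / 2) / √(2 * π))).sub
    (integrable_stdphi.const_mul (Real.log √(2 * π)))).congr (.of_forall fun t => ?_)
  have h : (√(2 * π)) ≠ 0 := by positivity
  have he : -(1 / 2) * t ^ 2 = -(t ^ 2) / 2 := by ring
  simp only [stdphi, Pi.sub_apply, he]
  rw [Real.log_div (Real.exp_ne_zero _) h, Real.log_exp]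
  ring

section Product

variable {ι : Type*} [Fintype ι] {k : ι → ℝ → ℝ}

lemma integral_prod_eq_one (hk : ∀ i, ∫ t, k i t = 1) : ∫ w : ι → ℝ, ∏ i, k i (w i) = 1 := by
  rw [integral_fintype_prod_volume_eq_prod]
  simp [hk]

/-- The entropy of a product density is the sum of the entropies of its factors. -/
lemma entropy_prod [DecidableEq ι] (hpos : ∀ i t, 0 < k i t) (hint : ∀ i, Integrable (k i))
    (hone : ∀ i, ∫ t, k i t = 1) (hlog : ∀ i, Integrable fun t => k i t * Real.log (k i t)) :
    Integrable (fun w : ι → ℝ => (∏ i, k i (w i)) * Real.log (∏ i, k i (w i))) ∧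
    ∫ w : ι → ℝ, (∏ i, k i (w i)) * Real.log (∏ i, k i (w i)) =
      ∑ i, ∫ t, k i t * Real.log (k i t) := by
  set l : ι → ι → ℝ → ℝ := fun i => Function.update k i fun t => k i t * Real.log (k i t) with hl
  have hexp : (fun w : ι → ℝ => (∏ i, k i (w i)) * Real.log (∏ i, k i (w i))) =
      fun w => ∑ i, ∏ j, l i j (w j) := by
    ext w
    rw [Real.log_prod (fun i _ => (hpos i (w i)).ne'), Finset.mul_sum]
    refine Finset.sum_congr rfl fun i _ => ?_
    rw [← Finset.mul_prod_erase _ _ (Finset.mem_univ i),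
      ← Finset.mul_prod_erase _ _ (Finset.mem_univ i)]
    have : ∏ j ∈ Finset.univ.erase i, l i j (w j) = ∏ j ∈ Finset.univ.erase i, k j (w j) :=
      Finset.prod_congr rfl fun j hj => by simp [hl, Finset.ne_of_mem_erase hj]
    rw [this]
    simp only [hl, Function.update_self]
    ring
  have hli : ∀ i j, Integrable (l i j) := fun i j => by
    by_cases h : j = i
    · subst h; simpa [hl] using hlog j
    · simpa [hl, h] using hint j
  have hP : ∀ i, Integrable fun w : ι → ℝ => ∏ j, l i j (w j) := fun i =>
    Integrable.fintype_prod (hli i)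
  rw [hexp]
  refine ⟨integrable_finsetSum _ fun i _ => hP i, ?_⟩
  rw [integral_finsetSum _ fun i _ => hP i]
  refine Finset.sum_congr rfl fun i _ => ?_
  rw [integral_fintype_prod_volume_eq_prod, Finset.prod_eq_single i]
  · simp [hl]
  · intro j _ hj; simp [hl, hj, hone]
  · simp

end Product

section LinearChange

variable {ι : Type*} [Fintype ι] [DecidableEq ι] {M : Matrix ι ι ℝ} {F : (ι → ℝ) → ℝ}

lemma integrable_map_toLin' (hM : M.det ≠ 0) (hF : Integrable F) :
    Integrable F (Measure.map (toLin' M) volume) := by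
  rw [Real.map_matrix_volume_pi_eq_smul_volume_pi hM]
  exact hF.smul_measure ENNReal.ofReal_ne_top

lemma integrable_comp_mulVec (hM : M.det ≠ 0) (hF : Integrable F) :
    Integrable fun z => F (M *ᵥ z) :=
  (integrable_map_toLin' hM hF).comp_measurable (toLin' M).continuous_of_finiteDimensional.measurable

lemma abs_det_mul_integral_comp_mulVec (hM : M.det ≠ 0) (hF : Integrable F) :
    ∫ z, |M.det| * F (M *ᵥ z) = ∫ w, F w := by
  have h := integral_map (μ := volume)
    (toLin' M).continuous_of_finiteDimensional.measurable.aemeasurable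
    (integrable_map_toLin' hM hF).aestronglyMeasurable
  simp only [toLin'_apply] at h
  rw [integral_const_mul, ← h, Real.map_matrix_volume_pi_eq_smul_volume_pi hM,
    integral_smul_measure, ENNReal.toReal_ofReal (abs_nonneg _), abs_inv, smul_eq_mul,
    mul_inv_cancel_left₀ (abs_ne_zero.mpr hM)]

end LinearChange

section Whitening

variable {ι : Type*} [Fintype ι] [DecidableEq ι]

/-- A Householder reflection moves a given vector onto a coordinate axis. -/
lemma exists_orthogonal_mulVec_eq_single (a : ι → ℝ) (i : ι) :
    ∃ U : Matrix ι ι ℝ, Uᵀ * U = 1 ∧ U *ᵥ a = √(a ⬝ᵥ a) • Pi.single i 1 := by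
  set b := √(a ⬝ᵥ a)
  have hb : b * b = a ⬝ᵥ a := Real.mul_self_sqrt (by
    simpa using dotProduct_star_self_nonneg a)
  set u := a - b • Pi.single i 1 with hu
  set c := u ⬝ᵥ u with hc
  have hua : c = 2 * (u ⬝ᵥ a) := by
    simp only [hc, hu, sub_dotProduct, dotProduct_sub, smul_dotProduct, dotProduct_smul,
      single_one_dotProduct, dotProduct_single_one, Pi.sub_apply, Pi.smul_apply,
      Pi.single_eq_same, smul_eq_mul]
    linear_combination hb
  have hc0 : c = 0 → u = 0 := fun h => dotProduct_self_eq_zero.mp h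
  refine ⟨1 - (2 / c) • vecMulVec u u, ?_, ?_⟩
  · by_cases h : c = 0
    · simp [h]
    · have : (vecMulVec u u) * vecMulVec u u = c • vecMulVec u u := by
        rw [vecMulVec_mul_vecMulVec, ← hc]; simp [vecMulVec_smul]
      simp only [transpose_sub, transpose_one, transpose_smul, transpose_vecMulVec, sub_mul,
        mul_sub, one_mul, mul_one, smul_mul_assoc, mul_smul_comm, this, smul_smul]
      have h2 : 2 / c * c = 2 := by field_simp
      rw [h2, two_smul]
      simp
  · rw [sub_mulVec, one_mulVec, smul_mulVec, vecMulVec_mulVec]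
    have : (2 / c) • (MulOpposite.op (u ⬝ᵥ a) • u) = u := by
      by_cases h : c = 0
      · simp [hc0 h]
      · have h1 : u ⬝ᵥ a = c / 2 := by linarith
        ext j; simp [h1]; field_simp
    rw [this, hu]; abel

open scoped MatrixOrder in
lemma Matrix.PosDef.exists_whitening {S : Matrix ι ι ℝ} (hS : S.PosDef) (a : ι → ℝ) (i : ι) :
    ∃ M : Matrix ι ι ℝ, Mᵀ * M = S⁻¹ ∧ M *ᵥ a = √(a ⬝ᵥ S⁻¹ *ᵥ a) • Pi.single i 1 := by
  obtain ⟨B, hB⟩ : ∃ B : Matrix ι ι ℝ, Bᵀ * B = S⁻¹ := by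
    obtain ⟨X, hX, -, h⟩ := CFC.exists_sqrt_of_isSelfAdjoint_of_quasispectrumRestricts
      hS.inv.isHermitian (QuasispectrumRestricts.nnreal_of_nonneg hS.inv.posSemidef.nonneg)
    refine ⟨X, ?_⟩
    rw [← conjTranspose_eq_transpose_of_trivial, ← star_eq_conjTranspose, hX.star_eq]
    exact h
  obtain ⟨U, hU, hUa⟩ := exists_orthogonal_mulVec_eq_single (B *ᵥ a) i
  refine ⟨U * B, ?_, ?_⟩
  · rw [transpose_mul, Matrix.mul_assoc, ← Matrix.mul_assoc Uᵀ, hU, Matrix.one_mul, hB]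
  · rw [← mulVec_mulVec, hUa, ← hB, ← mulVec_mulVec, dotProduct_mulVec a, vecMul_transpose]

lemma abs_det_whitening_sq {S M : Matrix ι ι ℝ} (hM : Mᵀ * M = S⁻¹) :
    |M.det| ^ 2 = S.det⁻¹ := by
  rw [sq_abs, ← Ring.inverse_eq_inv', ← det_nonsing_inv, ← hM, det_mul, det_transpose, sq]

end Whitening

section NormalDensity

variable {d : ℕ} {S : Matrix (Fin d) (Fin d) ℝ}

lemma mvn_pos (hS : S.PosDef) (z : Fin d → ℝ) : 0 < mvn d S z := by
  have := hS.det_pos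
  unfold mvn
  positivity

lemma continuous_mvn : Continuous (mvn d S) := by
  unfold mvn
  fun_prop

lemma mvn_le_mvn_zero (hS : S.PosDef) (z : Fin d → ℝ) : mvn d S z ≤ mvn d S 0 := by
  have h := hS.det_pos
  have hz : 0 ≤ z ⬝ᵥ S⁻¹ *ᵥ z := by
    simpa using hS.inv.posSemidef.dotProduct_mulVec_nonneg z
  unfold mvn
  gcongr
  simpa using hz

lemma mvn_eq_prod (hS : S.PosDef) {M : Matrix (Fin d) (Fin d) ℝ} (hM : Mᵀ * M = S⁻¹)
    (z : Fin d → ℝ) : mvn d S z = |M.det| * ∏ i, stdphi ((M *ᵥ z) i) := by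
  have hdet : S.det ^ (-(1 : ℝ) / 2) = |M.det| := by
    rw [← Real.sqrt_sq (abs_nonneg M.det), abs_det_whitening_sq hM, Real.sqrt_eq_rpow,
      Real.inv_rpow hS.det_pos.le, ← Real.rpow_neg hS.det_pos.le, neg_div]
  have hpi : (2 * π) ^ (-(d : ℝ) / 2) = (√(2 * π) ^ d)⁻¹ := by
    rw [Real.sqrt_eq_rpow, ← Real.rpow_natCast, ← Real.rpow_mul (by positivity),
      ← Real.rpow_neg (by positivity)]
    congr 1
    ring
  have hquad : z ⬝ᵥ S⁻¹ *ᵥ z = ∑ i, (M *ᵥ z) i ^ 2 := by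
    rw [← hM, ← mulVec_mulVec, dotProduct_mulVec, vecMul_transpose]
    simp [dotProduct, sq]
  simp only [mvn, stdphi, Finset.prod_div_distrib, ← Real.exp_sum, Finset.prod_const,
    Finset.card_univ, Fintype.card_fin]
  rw [hdet, hpi, hquad, ← Finset.sum_div, Finset.sum_neg_distrib]
  ring

lemma det_whitening_ne_zero (hS : S.PosDef) {M : Matrix (Fin d) (Fin d) ℝ}
    (hM : Mᵀ * M = S⁻¹) : M.det ≠ 0 := by
  intro h
  have := abs_det_whitening_sq hM
  have h2 := inv_pos.mpr hS.det_pos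
  rw [← this, h] at h2
  simp at h2

end NormalDensity

section Mixtures

/-- The standard normal location mixture `∫ φ(t − v b) dL(v)`. -/
noncomputable def stdMixture (b : ℝ) (L : Measure ℝ) (t : ℝ) : ℝ := ∫ v, stdphi (t - v * b) ∂L

/-- The multivariate normal mean mixture `∫ φ_d(z − v a; S) dL(v)`. -/
noncomputable def mvnMixture {d : ℕ} (S : Matrix (Fin d) (Fin d) ℝ) (a : Fin d → ℝ)
    (L : Measure ℝ) (z : Fin d → ℝ) : ℝ := ∫ v, mvn d S (z - v • a) ∂L

lemma integral_pos_of_pos {α : Type*} [MeasurableSpace α] {μ : Measure α} [IsProbabilityMeasure μ]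
    {f : α → ℝ} (hf : ∀ x, 0 < f x) (hint : Integrable f μ) : 0 < ∫ x, f x ∂μ := by
  rw [integral_pos_iff_support_of_nonneg (fun x => (hf x).le) hint]
  have : Function.support f = Set.univ := Set.eq_univ_of_forall fun x => (hf x).ne'
  simp [this]

lemma stdphi_le_stdphi_zero (t : ℝ) : stdphi t ≤ stdphi 0 := by
  unfold stdphi
  gcongr ?_ / _
  rw [Real.exp_le_exp]
  nlinarith [sq_nonneg t]

variable {b : ℝ} {L : Measure ℝ} {d : ℕ} {S : Matrix (Fin d) (Fin d) ℝ} {a : Fin d → ℝ}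

lemma stronglyMeasurable_mvnMixture [SFinite L] : StronglyMeasurable (mvnMixture S a L) :=
  StronglyMeasurable.integral_prod_right
    (Continuous.stronglyMeasurable (continuous_mvn.comp (by fun_prop)))

/-- In whitened coordinates a normal mean mixture is a product density, all of whose factors but
one are standard normal. -/
lemma mvnMixture_eq_prod (hS : S.PosDef) {M : Matrix (Fin d) (Fin d) ℝ} (hM : Mᵀ * M = S⁻¹)
    (i : Fin d) (hMa : M *ᵥ a = b • Pi.single i 1) (z : Fin d → ℝ) :
    mvnMixture S a L z =
      |M.det| * ∏ j, Function.update (fun _ => stdphi) i (stdMixture b L) j ((M *ᵥ z) j) := by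
  have key : ∀ v : ℝ, mvn d S (z - v • a) =
      |M.det| * (∏ j ∈ Finset.univ.erase i, stdphi ((M *ᵥ z) j)) *
        stdphi ((M *ᵥ z) i - v * b) := fun v => by
    rw [mvn_eq_prod hS hM, ← Finset.prod_erase_mul _ _ (Finset.mem_univ i), mulVec_sub,
      mulVec_smul, hMa, ← mul_assoc]
    congr 2
    · refine Finset.prod_congr rfl fun j hj => ?_
      simp [Finset.ne_of_mem_erase hj]
    · simp
  unfold mvnMixture
  simp_rw [key]
  rw [integral_const_mul, ← Finset.prod_erase_mul _ _ (Finset.mem_univ i), ← mul_assoc]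
  congr 2
  · refine Finset.prod_congr rfl fun j hj => ?_
    simp [Finset.ne_of_mem_erase hj]
  · simp [stdMixture]

variable [IsProbabilityMeasure L]

lemma stdMixture_pos (t : ℝ) : 0 < stdMixture b L t := by
  refine integral_pos_of_pos (fun v => stdphi_pos _) ?_
  refine .of_bound (C := stdphi 0) (Continuous.aestronglyMeasurable
    (continuous_stdphi.comp (by fun_prop))) (.of_forall fun v => ?_)
  rw [Real.norm_of_nonneg (stdphi_pos _).le]
  exact stdphi_le_stdphi_zero _

lemma integrable_uncurry_stdphi :
    Integrable (fun x : ℝ × ℝ => stdphi (x.1 - x.2 * b)) (volume.prod L) := by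
  have hcont : Continuous fun x : ℝ × ℝ => stdphi (x.1 - x.2 * b) :=
    continuous_stdphi.comp (by fun_prop)
  rw [integrable_prod_iff' hcont.aestronglyMeasurable]
  refine ⟨.of_forall fun v => integrable_stdphi.comp_sub_right (v * b), ?_⟩
  simp [Real.norm_of_nonneg (stdphi_pos _).le, integral_sub_right_eq_self stdphi]

lemma integrable_stdMixture : Integrable (stdMixture b L) :=
  integrable_uncurry_stdphi.integral_prod_left

lemma integral_stdMixture : ∫ t, stdMixture b L t = 1 := by
  unfold stdMixture
  rw [integral_integral_swap integrable_uncurry_stdphi]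
  simp [integral_sub_right_eq_self stdphi, integral_stdphi]

lemma integrable_mvn_sub_smul (hS : S.PosDef) (z : Fin d → ℝ) :
    Integrable (fun v : ℝ => mvn d S (z - v • a)) L := by
  refine .of_bound (C := mvn d S 0) (Continuous.aestronglyMeasurable
    (continuous_mvn.comp (by fun_prop))) (.of_forall fun v => ?_)
  rw [Real.norm_of_nonneg (mvn_pos hS _).le]
  exact mvn_le_mvn_zero hS _

lemma mvnMixture_pos (hS : S.PosDef) (z : Fin d → ℝ) : 0 < mvnMixture S a L z :=
  integral_pos_of_pos (fun _ => mvn_pos hS _) (integrable_mvn_sub_smul hS z)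

lemma integrable_update_stdMixture (i j : Fin d) :
    Integrable (Function.update (fun _ => stdphi) i (stdMixture b L) j) := by
  by_cases h : j = i
  · subst h; simpa using integrable_stdMixture
  · simpa [h] using integrable_stdphi

lemma integral_update_stdMixture (i j : Fin d) :
    ∫ t, Function.update (fun _ => stdphi) i (stdMixture b L) j t = 1 := by
  by_cases h : j = i
  · subst h; simpa using integral_stdMixture
  · simpa [h] using integral_stdphi

lemma update_stdMixture_pos (i j : Fin d) (t : ℝ) :
    0 < Function.update (fun _ => stdphi) i (stdMixture b L) j t := by
  by_cases h : j = i
  · subst h; simpa using stdMixture_pos t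
  · simpa [h] using stdphi_pos t

lemma integrable_mvnMixture [NeZero d] (hS : S.PosDef) : Integrable (mvnMixture S a L) := by
  obtain ⟨M, hM, hMa⟩ := hS.exists_whitening a 0
  rw [funext fun z => mvnMixture_eq_prod (L := L) hS hM 0 hMa z]
  exact (integrable_comp_mulVec (det_whitening_ne_zero hS hM)
    (Integrable.fintype_prod (integrable_update_stdMixture 0))).const_mul _

lemma integral_mvnMixture [NeZero d] (hS : S.PosDef) : ∫ z, mvnMixture S a L z = 1 := by
  obtain ⟨M, hM, hMa⟩ := hS.exists_whitening a 0
  simp_rw [mvnMixture_eq_prod (L := L) hS hM 0 hMa]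
  rw [abs_det_mul_integral_comp_mulVec (F := fun w => ∏ j, Function.update (fun _ => stdphi) 0
    (stdMixture (√(a ⬝ᵥ S⁻¹ *ᵥ a)) L) j (w j)) (det_whitening_ne_zero hS hM)
    (Integrable.fintype_prod (integrable_update_stdMixture 0))]
  exact integral_prod_eq_one (integral_update_stdMixture 0)

/-- The differential entropy of a normal mean mixture reduces to that of its univariate
projection in the mixing direction. -/
lemma entropy_mvnMixture [NeZero d] (hS : S.PosDef) {g : ℝ → ℝ}
    (hg : g = stdMixture (√(a ⬝ᵥ S⁻¹ *ᵥ a)) L)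
    (hlog : Integrable fun t => g t * Real.log (g t)) :
    Integrable (fun z => mvnMixture S a L z * Real.log (mvnMixture S a L z)) ∧
    ∫ z, mvnMixture S a L z * Real.log (mvnMixture S a L z) =
      -(1 / 2) * Real.log S.det + (∫ t, g t * Real.log (g t)) +
        ∑ _j ∈ Finset.univ.erase (0 : Fin d), ∫ t, stdphi t * Real.log (stdphi t) := by
  subst hg
  obtain ⟨M, hM, hMa⟩ := hS.exists_whitening a 0
  have hdet := det_whitening_ne_zero hS hM
  set k : Fin d → ℝ → ℝ := Function.update (fun _ => stdphi) 0
    (stdMixture (√(a ⬝ᵥ S⁻¹ *ᵥ a)) L) with hk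
  set P : (Fin d → ℝ) → ℝ := fun w => ∏ j, k j (w j) with hP
  have hPpos : ∀ w, 0 < P w := fun w => Finset.prod_pos fun j _ => update_stdMixture_pos 0 j _
  have hPint : Integrable P := Integrable.fintype_prod (integrable_update_stdMixture 0)
  have hPone : ∫ w, P w = 1 := integral_prod_eq_one (integral_update_stdMixture 0)
  obtain ⟨hPlog, hPent⟩ := entropy_prod (k := k) (update_stdMixture_pos 0)
    (integrable_update_stdMixture 0) (integral_update_stdMixture 0) fun j => by
      by_cases h : j = 0
      · subst h; simpa [hk] using hlog
      · simpa [hk, h] using integrable_stdphi_mul_log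
  have hF : Integrable fun w => P w * Real.log |M.det| + P w * Real.log (P w) :=
    (hPint.mul_const _).add hPlog
  have hf : (fun z => mvnMixture S a L z * Real.log (mvnMixture S a L z)) = fun z =>
      |M.det| * (P (M *ᵥ z) * Real.log |M.det| + P (M *ᵥ z) * Real.log (P (M *ᵥ z))) := by
    ext z
    rw [mvnMixture_eq_prod (L := L) hS hM 0 hMa]
    change |M.det| * P (M *ᵥ z) * Real.log (|M.det| * P (M *ᵥ z)) = _
    rw [Real.log_mul (abs_ne_zero.mpr hdet) (hPpos _).ne']
    ring
  have hlogdet : Real.log |M.det| = -(1 / 2) * Real.log S.det := by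
    have := congrArg Real.log (abs_det_whitening_sq hM)
    rw [Real.log_pow, Real.log_inv] at this
    push_cast at this
    linarith
  rw [hf]
  refine ⟨(integrable_comp_mulVec hdet hF).const_mul _, ?_⟩
  rw [abs_det_mul_integral_comp_mulVec
    (F := fun w => P w * Real.log |M.det| + P w * Real.log (P w)) hdet hF,
    integral_add (hPint.mul_const _) hPlog, integral_mul_const, hPone, hPent, hlogdet, one_mul,
    add_assoc]
  congr 1
  rw [← Finset.add_sum_erase _ (fun j => ∫ t, k j t * Real.log (k j t)) (Finset.mem_univ 0)]
  refine congrArg₂ _ (by simp [hk]) (Finset.sum_congr rfl fun j hj => ?_)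
  simp [hk, Finset.ne_of_mem_erase hj]

lemma mvnMixture_dirac (z : Fin d → ℝ) : mvnMixture S a (Measure.dirac 0) z = mvn d S z := by
  simp [mvnMixture]

lemma integral_mvn [NeZero d] (hS : S.PosDef) : ∫ z, mvn d S z = 1 := by
  simpa [mvnMixture_dirac] using integral_mvnMixture (a := 0) (L := Measure.dirac 0) hS

lemma integrable_mvn [NeZero d] (hS : S.PosDef) : Integrable (mvn d S) := by
  simpa [funext mvnMixture_dirac] using
    integrable_mvnMixture (a := 0) (L := Measure.dirac 0) hS

end Mixtures

section Convolution

variable {d : ℕ} {SX SY : Matrix (Fin d) (Fin d) ℝ}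

lemma Matrix.PosDef.dotProduct_mulVec_comm {ι : Type*} [Fintype ι] {A : Matrix ι ι ℝ}
    (hA : A.PosDef) (x y : ι → ℝ) : x ⬝ᵥ A *ᵥ y = y ⬝ᵥ A *ᵥ x := by
  have hT : Aᵀ = A := by
    rw [← conjTranspose_eq_transpose_of_trivial]; exact hA.isHermitian
  rw [dotProduct_mulVec, ← mulVec_transpose, hT, dotProduct_comm]

/-- Completing the square in a product of two centered normal densities. -/
lemma mvn_mul_mvn_add (hX : SX.PosDef) (hY : SY.PosDef) (x z : Fin d → ℝ) :
    mvn d SX x * mvn d SY (x + z) =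
      mvn d (SX + SY) z * mvn d (SX⁻¹ + SY⁻¹)⁻¹ (x + SX *ᵥ (SX + SY)⁻¹ *ᵥ z) := by
  have hS := hX.add hY
  have hK := hX.inv.add hY.inv
  have hXu : IsUnit SX.det := hX.det_pos.ne'.isUnit
  have hYu : IsUnit SY.det := hY.det_pos.ne'.isUnit
  have hSu : IsUnit (SX + SY).det := hS.det_pos.ne'.isUnit
  have hKu : IsUnit (SX⁻¹ + SY⁻¹).det := hK.det_pos.ne'.isUnit
  have hdet : SX.det ^ (-(1 : ℝ) / 2) * SY.det ^ (-(1 : ℝ) / 2) =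
      (SX + SY).det ^ (-(1 : ℝ) / 2) * (SX⁻¹ + SY⁻¹)⁻¹.det ^ (-(1 : ℝ) / 2) := by
    rw [← Real.mul_rpow hX.det_pos.le hY.det_pos.le,
      ← Real.mul_rpow hS.det_pos.le hK.inv.det_pos.le]
    congr 1
    have h : SX * (SX⁻¹ + SY⁻¹) * SY = SX + SY := by
      rw [Matrix.mul_add, Matrix.add_mul, Matrix.mul_nonsing_inv _ hXu, Matrix.one_mul,
        Matrix.mul_assoc, Matrix.nonsing_inv_mul _ hYu, Matrix.mul_one, add_comm]
    rw [← h, det_mul, det_mul, det_nonsing_inv, Ring.inverse_eq_inv']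
    have := hKu.ne_zero
    field_simp
  set w := (SX + SY)⁻¹ *ᵥ z with hw
  have hz : z = SX *ᵥ w + SY *ᵥ w := by
    rw [← add_mulVec, hw, mulVec_mulVec, Matrix.mul_nonsing_inv _ hSu, one_mulVec]
  have hBY : SY⁻¹ *ᵥ SY *ᵥ w = w := by
    rw [mulVec_mulVec, Matrix.nonsing_inv_mul _ hYu, one_mulVec]
  have hKm : (SX⁻¹ + SY⁻¹) *ᵥ SX *ᵥ w = SY⁻¹ *ᵥ z := by
    rw [add_mulVec, mulVec_mulVec, Matrix.nonsing_inv_mul _ hXu, one_mulVec]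
    conv_rhs => rw [hz, mulVec_add, hBY, add_comm]
  have hquad : x ⬝ᵥ SX⁻¹ *ᵥ x + (x + z) ⬝ᵥ SY⁻¹ *ᵥ (x + z) =
      z ⬝ᵥ w + (x + SX *ᵥ w) ⬝ᵥ (SX⁻¹ + SY⁻¹) *ᵥ (x + SX *ᵥ w) := by
    have h1 : (SX *ᵥ w) ⬝ᵥ (SX⁻¹ + SY⁻¹) *ᵥ x = x ⬝ᵥ SY⁻¹ *ᵥ z := by
      rw [hK.dotProduct_mulVec_comm, hKm]
    have h2 : z ⬝ᵥ SY⁻¹ *ᵥ z = (SX *ᵥ w) ⬝ᵥ SY⁻¹ *ᵥ z + z ⬝ᵥ w := by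
      have h3 : (SY *ᵥ w) ⬝ᵥ SY⁻¹ *ᵥ z = z ⬝ᵥ w := by rw [hY.inv.dotProduct_mulVec_comm, hBY]
      rw [← h3, ← add_dotProduct, ← hz]
    rw [mulVec_add _ x (SX *ᵥ w), hKm]
    simp only [mulVec_add, add_dotProduct, dotProduct_add, h1, h2,
      hY.inv.dotProduct_mulVec_comm z x]
    rw [add_mulVec, dotProduct_add]
    ring
  have hexp : Real.exp (-(x ⬝ᵥ SX⁻¹ *ᵥ x) / 2) *
      Real.exp (-((x + z) ⬝ᵥ SY⁻¹ *ᵥ (x + z)) / 2) = Real.exp (-(z ⬝ᵥ w) / 2) *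
      Real.exp (-((x + SX *ᵥ w) ⬝ᵥ (SX⁻¹ + SY⁻¹) *ᵥ (x + SX *ᵥ w)) / 2) := by
    rw [← Real.exp_add, ← Real.exp_add]
    congr 1
    linarith
  simp only [mvn, nonsing_inv_nonsing_inv _ hKu]
  linear_combination ((2 * π) ^ (-(d : ℝ) / 2)) ^ 2 *
    (Real.exp (-(x ⬝ᵥ SX⁻¹ *ᵥ x) / 2) * Real.exp (-((x + z) ⬝ᵥ SY⁻¹ *ᵥ (x + z)) / 2) * hdet +
      (SX + SY).det ^ (-(1 : ℝ) / 2) * (SX⁻¹ + SY⁻¹)⁻¹.det ^ (-(1 : ℝ) / 2) * hexp)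

lemma integrable_mvn_mul_mvn [NeZero d] (hX : SX.PosDef) (hY : SY.PosDef) (α z : Fin d → ℝ) :
    Integrable fun x => mvn d SX (x - α) * mvn d SY (x + z) := by
  have h (x : Fin d → ℝ) : mvn d SX (x - α) * mvn d SY (x + z) =
      mvn d SX (x - α) * mvn d SY (x - α + (z + α)) := by
    congr 2
    abel
  simp_rw [h, mvn_mul_mvn_add hX hY]
  exact (((integrable_mvn (hX.inv.add hY.inv).inv).comp_add_right _).const_mul _).comp_sub_right α

lemma integral_mvn_mul_mvn [NeZero d] (hX : SX.PosDef) (hY : SY.PosDef) (α z : Fin d → ℝ) :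
    ∫ x, mvn d SX (x - α) * mvn d SY (x + z) = mvn d (SX + SY) (z + α) := by
  have h (x : Fin d → ℝ) : mvn d SX (x - α) * mvn d SY (x + z) =
      mvn d SX (x - α) * mvn d SY (x - α + (z + α)) := by
    congr 2
    abel
  simp_rw [h]
  rw [integral_sub_right_eq_self fun x => mvn d SX x * mvn d SY (x + (z + α))]
  simp_rw [mvn_mul_mvn_add hX hY]
  rw [integral_const_mul, integral_add_right_eq_self (mvn d (SX⁻¹ + SY⁻¹)⁻¹),
    integral_mvn (hX.inv.add hY.inv).inv, mul_one]

variable {a : Fin d → ℝ} {L₁ L₂ : Measure ℝ} [IsProbabilityMeasure L₁] [IsProbabilityMeasure L₂]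

/-- The difference of two independent normal mean mixtures is a normal mean mixture. -/
lemma mvnMixture_conv [NeZero d] (hX : SX.PosDef) (hY : SY.PosDef) (z : Fin d → ℝ) :
    Integrable (fun x => mvnMixture SX a L₁ x * mvnMixture SY a L₂ (x + z)) ∧
    ∫ x, mvnMixture SX a L₁ x * mvnMixture SY a L₂ (x + z) =
      mvnMixture (SX + SY) a (Measure.map (fun v : ℝ × ℝ => v.2 - v.1) (L₁.prod L₂)) z := by
  have hS := hX.add hY
  have hcont : Continuous fun s : (Fin d → ℝ) × (ℝ × ℝ) =>
      mvn d SX (s.1 - s.2.1 • a) * mvn d SY (s.1 + (z - s.2.2 • a)) :=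
    (continuous_mvn.comp (by fun_prop)).mul (continuous_mvn.comp (by fun_prop))
  have hval (v : ℝ × ℝ) : ∫ x, mvn d SX (x - v.1 • a) * mvn d SY (x + (z - v.2 • a)) =
      mvn d (SX + SY) (z - (v.2 - v.1) • a) := by
    rw [integral_mvn_mul_mvn hX hY]
    congr 1
    module
  have hint : Integrable (fun s : (Fin d → ℝ) × (ℝ × ℝ) =>
      mvn d SX (s.1 - s.2.1 • a) * mvn d SY (s.1 + (z - s.2.2 • a)))
      (volume.prod (L₁.prod L₂)) := by
    rw [integrable_prod_iff' hcont.aestronglyMeasurable]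
    refine ⟨.of_forall fun v => integrable_mvn_mul_mvn hX hY (v.1 • a) (z - v.2 • a), ?_⟩
    simp_rw [Real.norm_of_nonneg (mul_pos (mvn_pos hX _) (mvn_pos hY _)).le, hval]
    refine .of_bound (C := mvn d (SX + SY) 0) (Continuous.aestronglyMeasurable
      (continuous_mvn.comp (by fun_prop))) (.of_forall fun v => ?_)
    rw [Real.norm_of_nonneg (mvn_pos hS _).le]
    exact mvn_le_mvn_zero hS _
  have hprod : (fun x => mvnMixture SX a L₁ x * mvnMixture SY a L₂ (x + z)) = fun x =>
      ∫ v, mvn d SX (x - v.1 • a) * mvn d SY (x + (z - v.2 • a)) ∂(L₁.prod L₂) := by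
    ext x
    rw [integral_prod_mul (fun v => mvn d SX (x - v • a)) fun v => mvn d SY (x + (z - v • a))]
    simp only [mvnMixture, add_sub_assoc]
  rw [hprod]
  refine ⟨hint.integral_prod_left, ?_⟩
  have hcontS : Continuous fun v : ℝ => mvn d (SX + SY) (z - v • a) :=
    continuous_mvn.comp (by fun_prop)
  rw [integral_integral_swap hint, mvnMixture,
    integral_map (by fun_prop) hcontS.aestronglyMeasurable]
  exact integral_congr_ae (.of_forall hval)

/-- The expected logarithm of a location family evaluated at the difference of two independent
variables reduces to an integral against the density of that difference. -/
lemma integral_integral_mul_log {f g h : (Fin d → ℝ) → ℝ} (hf : StronglyMeasurable f)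
    (hg : StronglyMeasurable g) (hh : StronglyMeasurable h) (hf0 : ∀ x, 0 ≤ f x)
    (hg0 : ∀ x, 0 ≤ g x) (hh0 : ∀ x, 0 ≤ h x)
    (hint : ∀ z, Integrable fun x => f x * g (x + z)) (hconv : ∀ z, ∫ x, f x * g (x + z) = h z)
    (hlog : Integrable fun z => h z * Real.log (h z)) :
    Integrable (fun x => (∫ y, g y * Real.log (h (y - x))) * f x) ∧
    ∫ x, (∫ y, g y * Real.log (h (y - x))) * f x = ∫ z, h z * Real.log (h z) := by
  have hmeas : StronglyMeasurable fun s : (Fin d → ℝ) × (Fin d → ℝ) =>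
      f s.1 * g (s.1 + s.2) * Real.log (h s.2) :=
    ((hf.comp_measurable measurable_fst).mul
      (hg.comp_measurable (measurable_fst.add measurable_snd))).mul
      (Real.measurable_log.comp (hh.measurable.comp measurable_snd)).stronglyMeasurable
  have hI : Integrable (fun s : (Fin d → ℝ) × (Fin d → ℝ) =>
      f s.1 * g (s.1 + s.2) * Real.log (h s.2)) (volume.prod volume) := by
    rw [integrable_prod_iff' hmeas.aestronglyMeasurable]
    refine ⟨.of_forall fun z => (hint z).mul_const (Real.log (h z)), ?_⟩
    refine hlog.norm.congr (.of_forall fun z => ?_)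
    simp only [norm_mul]
    rw [integral_mul_const, Real.norm_of_nonneg (hh0 z), ← hconv z]
    simp only [Real.norm_of_nonneg (hf0 _), Real.norm_of_nonneg (hg0 _)]
  have heq : (fun x => (∫ y, g y * Real.log (h (y - x))) * f x) = fun x =>
      ∫ z, f x * g (x + z) * Real.log (h z) := by
    ext x
    rw [← integral_add_left_eq_self _ x, mul_comm, ← integral_const_mul]
    simp only [add_sub_cancel_left, mul_assoc]
  rw [heq]
  refine ⟨hI.integral_prod_left, ?_⟩
  rw [integral_integral_swap hI]
  simp_rw [integral_mul_const, hconv]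

end Convolution

/-- the Kullback–Leibler risk of the MRE predictive density `q̂_U` for MMN
models is constant in `θ` and equals
`H(g_S) − H(g_Y) + (1/2) log(det Σ_S / det Σ_Y)`. -/
theorem mre_kl_risk_constant
    (d : ℕ) (hd : 1 ≤ d) (a : Fin d → ℝ)
    (SX SY : Matrix (Fin d) (Fin d) ℝ) (hSX : SX.PosDef) (hSY : SY.PosDef)
    (SS : Matrix (Fin d) (Fin d) ℝ) (hSS : SS = SX + SY)
    (L₁ L₂ : Measure ℝ) [IsProbabilityMeasure L₁] [IsProbabilityMeasure L₂]
    (L₃ : Measure ℝ) (hL₃ : L₃ = Measure.map (fun v : ℝ × ℝ => v.2 - v.1) (L₁.prod L₂))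
    (p q : (Fin d → ℝ) → (Fin d → ℝ) → ℝ)
    (hp : p = fun x θ => ∫ v₁, mvn d SX (x - θ - v₁ • a) ∂L₁)
    (hq : q = fun y θ => ∫ v₂, mvn d SY (y - θ - v₂ • a) ∂L₂)
    (qU : (Fin d → ℝ) → (Fin d → ℝ) → ℝ)
    (hqU : qU = fun y x => ∫ u, mvn d SS (y - x - u • a) ∂L₃)
    (gS gY : ℝ → ℝ)
    (hgS : gS = fun t => ∫ u, stdphi (t - u * Real.sqrt (a ⬝ᵥ SS⁻¹ *ᵥ a)) ∂L₃)
    (hgY : gY = fun t => ∫ v, stdphi (t - v * Real.sqrt (a ⬝ᵥ SY⁻¹ *ᵥ a)) ∂L₂)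
    (hint_S : Integrable (fun t : ℝ => gS t * Real.log (gS t)))
    (hint_Y : Integrable (fun t : ℝ => gY t * Real.log (gY t)))
    (R : (Fin d → ℝ) → ℝ)
    (hR : R = fun θ => ∫ x : Fin d → ℝ,
        (∫ y : Fin d → ℝ, q y θ * Real.log (q y θ / qU y x)) * p x θ)
    (hwell₁ : ∀ θ x : Fin d → ℝ,
        Integrable (fun y : Fin d → ℝ => q y θ * Real.log (q y θ / qU y x)))
    (hwell₂ : ∀ θ : Fin d → ℝ,
        Integrable (fun x : Fin d → ℝ =>
          (∫ y : Fin d → ℝ, q y θ * Real.log (q y θ / qU y x)) * p x θ)) :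
    ∀ θ : Fin d → ℝ,
      R θ = (-∫ t : ℝ, gS t * Real.log (gS t)) - (-∫ t : ℝ, gY t * Real.log (gY t))
              + (1 / 2) * Real.log (SS.det / SY.det) := by
  intro θ
  have : NeZero d := ⟨by omega⟩
  have hS : SS.PosDef := hSS ▸ hSX.add hSY
  have : IsProbabilityMeasure L₃ := by
    rw [hL₃]
    exact Measure.isProbabilityMeasure_map (by fun_prop)
  have hp' (x : Fin d → ℝ) : p x θ = mvnMixture SX a L₁ (x - θ) := by rw [hp]; rfl
  have hq' (y : Fin d → ℝ) : q y θ = mvnMixture SY a L₂ (y - θ) := by rw [hq]; rfl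
  have hqU' (y x : Fin d → ℝ) : qU y x = mvnMixture SS a L₃ (y - x) := by rw [hqU]; rfl
  obtain ⟨hlogS, hentS⟩ := entropy_mvnMixture hS hgS hint_S
  obtain ⟨hlogY, hentY⟩ := entropy_mvnMixture hSY hgY hint_Y
  have hpint : Integrable fun x => p x θ := by
    simp_rw [hp']
    exact (integrable_mvnMixture hSX).comp_sub_right θ
  have hpone : ∫ x, p x θ = 1 := by
    simp_rw [hp']
    rw [integral_sub_right_eq_self (mvnMixture SX a L₁), integral_mvnMixture hSX]
  have hqlog : Integrable fun y => q y θ * Real.log (q y θ) := by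
    simp_rw [hq']
    exact hlogY.comp_sub_right θ
  have hqent : ∫ y, q y θ * Real.log (q y θ) =
      ∫ z, mvnMixture SY a L₂ z * Real.log (mvnMixture SY a L₂ z) := by
    simp_rw [hq']
    exact integral_sub_right_eq_self
      (fun z => mvnMixture SY a L₂ z * Real.log (mvnMixture SY a L₂ z)) θ
  have hshift (x z : Fin d → ℝ) : x + z - θ = x - θ + z := by abel
  obtain ⟨hcross, hcrossval⟩ := integral_integral_mul_log
    (f := fun x => p x θ) (g := fun y => q y θ) (h := mvnMixture SS a L₃)
    (by simp_rw [hp']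
        exact stronglyMeasurable_mvnMixture.comp_measurable (measurable_id.sub_const θ))
    (by simp_rw [hq']
        exact stronglyMeasurable_mvnMixture.comp_measurable (measurable_id.sub_const θ))
    stronglyMeasurable_mvnMixture
    (fun x => by rw [hp']; exact (mvnMixture_pos hSX _).le)
    (fun y => by rw [hq']; exact (mvnMixture_pos hSY _).le)
    (fun z => (mvnMixture_pos hS z).le)
    (fun z => by
      simp_rw [hp', hq', hshift]
      exact (mvnMixture_conv hSX hSY z).1.comp_sub_right θ)
    (fun z => by
      simp_rw [hp', hq', hshift]
      rw [integral_sub_right_eq_self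
        fun x => mvnMixture SX a L₁ x * mvnMixture SY a L₂ (x + z),
        (mvnMixture_conv hSX hSY z).2, hSS, hL₃])
    hlogS
  have hinner (x : Fin d → ℝ) : ∫ y, q y θ * Real.log (q y θ / qU y x) =
      (∫ y, q y θ * Real.log (q y θ)) - ∫ y, q y θ * Real.log (mvnMixture SS a L₃ (y - x)) := by
    have hsplit (y : Fin d → ℝ) : q y θ * Real.log (mvnMixture SS a L₃ (y - x)) =
        q y θ * Real.log (q y θ) - q y θ * Real.log (q y θ / qU y x) := by
      rw [hqU', Real.log_div (by rw [hq']; exact (mvnMixture_pos hSY _).ne')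
        (mvnMixture_pos hS _).ne']
      ring
    simp_rw [hsplit]
    rw [integral_sub hqlog (hwell₁ θ x)]
    ring
  have hdet : Real.log (SS.det / SY.det) = Real.log SS.det - Real.log SY.det :=
    Real.log_div hS.det_pos.ne' hSY.det_pos.ne'
  simp only [hR, hinner, sub_mul]
  rw [integral_sub (hpint.const_mul _) hcross, integral_const_mul, hpone, hcrossval, hqent,
    hentS, hentY, hdet]
  ring
end

section
/- Let d ≥ 1, a ∈ ℝ^d, Σ and Δ positive definite d×d matrices, μ ∈ ℝ^d, and let g be a probability density on ℝ. Consider the model density p(x|θ) = ∫_ℝ φ_d(x − θ − v a; Σ) g(v) dv and the prior density π(θ) = φ_d(θ − μ; Δ). Set P := Σ(Σ + Δ)⁻¹, A := aᵀ(Σ + Δ)⁻¹a, B := (x − μ)ᵀ(Σ + Δ)⁻¹a, and g_{π,x}(v) := g(v) e^{−Av²/2 + Bv} / ∫_ℝ g(u) e^{−Au²/2 + Bu} du (assumed finite and positive). Then for every x ∈ ℝ^d the posterior density π(θ|x) := φ_d(θ − μ; Δ) p(x|θ) / ∫_{ℝ^d} φ_d(θ' − μ; Δ) p(x|θ') dθ'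 satisfies π(θ|x) = ∫_ℝ φ_d( θ − (I − P)x − Pμ + v (I − P)a ; (I − P)Σ ) g_{π,x}(v) dv for all θ ∈ ℝ^d; that is, the posterior is MMN_d((I−P)x + Pμ, −(I−P)a, (I−P)Σ, L*) with L* having density g_{π,x}. (Here (I − P)Σ = (Σ⁻¹ + Δ⁻¹)⁻¹ is symmetric positive definite.) -/
open MeasureTheory Matrix Real

/-- The normalizing integral of the standard Gaussian on `ι → ℝ`. -/
theorem integral_exp_neg_dotProduct_self {ι : Type*} [Fintype ι] :
    ∫ y : ι → ℝ, Real.exp (-(y ⬝ᵥ y) / 2) = (2 * π) ^ ((Fintype.card ι : ℝ) / 2) := by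
  have h : ∀ y : ι → ℝ, Real.exp (-(y ⬝ᵥ y) / 2) = ∏ i, Real.exp (-(1 / 2) * y i ^ 2) := by
    intro y
    rw [← Real.exp_sum, ← Finset.mul_sum]
    congr 1
    simp only [dotProduct, sq]
    ring
  simp_rw [h]
  rw [integral_fintype_prod_volume_eq_pow (fun t : ℝ => Real.exp (-(1 / 2) * t ^ 2)),
    integral_gaussian, Real.sqrt_eq_rpow, ← Real.rpow_natCast, ← Real.rpow_mul (by positivity)]
  congr 1 <;> ring

theorem integral_comp_mulVec {ι : Type*} [Fintype ι] [DecidableEq ι] {M : Matrix ι ι ℝ}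
    (hM : M.det ≠ 0) {f : (ι → ℝ) → ℝ} (hf : Continuous f) :
    ∫ y, f (M *ᵥ y) = |M.det|⁻¹ * ∫ y, f y := by
  have h := integral_map (μ := (volume : Measure (ι → ℝ))) (φ := Matrix.toLin' M) (f := f)
    (LinearMap.continuous_on_pi _).aemeasurable hf.aestronglyMeasurable
  rw [Real.map_matrix_volume_pi_eq_smul_volume_pi hM, integral_smul_measure,
    ENNReal.toReal_ofReal (abs_nonneg _), abs_inv, smul_eq_mul] at h
  simpa [Matrix.toLin'_apply] using h.symm

theorem continuous_mvn_s8 (d : ℕ) (C : Matrix (Fin d) (Fin d) ℝ) : Continuous (mvn d C) := by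
  unfold mvn
  fun_prop

theorem mvn_pos_s8 {d : ℕ} {C : Matrix (Fin d) (Fin d) ℝ} (hC : C.PosDef) (z : Fin d → ℝ) :
    0 < mvn d C z := by
  have := hC.det_pos
  unfold mvn
  positivity

open scoped MatrixOrder in
theorem exists_inv_eq_transpose_mul_self {ι : Type*} [Fintype ι] [DecidableEq ι]
    {C : Matrix ι ι ℝ} (hC : C.PosDef) : ∃ M : Matrix ι ι ℝ, C⁻¹ = Mᵀ * M := by
  obtain ⟨M, hM⟩ := CStarAlgebra.nonneg_iff_eq_star_mul_self.mp hC.inv.posSemidef.nonneg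
  exact ⟨M, by rw [hM, star_eq_conjTranspose, conjTranspose_eq_transpose_of_trivial]⟩

theorem integral_mvn_s8 {d : ℕ} {C : Matrix (Fin d) (Fin d) ℝ} (hC : C.PosDef) :
    ∫ z, mvn d C z = 1 := by
  obtain ⟨M, hM⟩ := exists_inv_eq_transpose_mul_self hC
  have hdet : C.det⁻¹ = M.det ^ 2 := by
    rw [← Ring.inverse_eq_inv', ← det_nonsing_inv, hM, det_mul, det_transpose, sq]
  have hCdet := hC.det_pos
  have hMdet : M.det ≠ 0 := by
    intro h
    simp [h, hCdet.ne'] at hdet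
  have hq : ∀ z, z ⬝ᵥ C⁻¹ *ᵥ z = (M *ᵥ z) ⬝ᵥ (M *ᵥ z) := by
    intro z
    rw [hM, ← mulVec_mulVec, dotProduct_mulVec, vecMul_transpose]
  have hsqrt : C.det ^ (-(1 : ℝ) / 2) = |M.det| := by
    rw [neg_div, Real.rpow_neg hCdet.le, ← Real.inv_rpow hCdet.le, hdet, ← Real.sqrt_eq_rpow,
      Real.sqrt_sq_eq_abs]
  simp only [mvn, hq]
  rw [integral_const_mul,
    integral_comp_mulVec (f := fun y => Real.exp (-(y ⬝ᵥ y) / 2)) hMdet (by fun_prop),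
    integral_exp_neg_dotProduct_self, hsqrt, Fintype.card_fin, neg_div,
    Real.rpow_neg (by positivity)]
  have : (2 * π) ^ ((d : ℝ) / 2) ≠ 0 := by positivity
  field_simp

/-- Completing the square in a sum of two quadratic forms. -/
theorem dotProduct_inv_mulVec_add {ι : Type*} [Fintype ι] [DecidableEq ι] {S D : Matrix ι ι ℝ}
    (hS : S.PosDef) (hD : D.PosDef) (y z : ι → ℝ) :
    y ⬝ᵥ D⁻¹ *ᵥ y + z ⬝ᵥ S⁻¹ *ᵥ z =
      (y + z) ⬝ᵥ (S + D)⁻¹ *ᵥ (y + z) +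
        (y - D *ᵥ ((S + D)⁻¹ *ᵥ (y + z))) ⬝ᵥ
          (D⁻¹ + S⁻¹) *ᵥ (y - D *ᵥ ((S + D)⁻¹ *ᵥ (y + z))) := by
  have hSu := (isUnit_iff_isUnit_det _).mp hS.isUnit
  have hDu := (isUnit_iff_isUnit_det _).mp hD.isUnit
  have hSDu := (isUnit_iff_isUnit_det _).mp (hS.add hD).isUnit
  set t := (S + D)⁻¹ *ᵥ (y + z) with ht
  set u := y - D *ᵥ t with hu
  have hw : y + z = S *ᵥ t + D *ᵥ t := by
    rw [← add_mulVec, ht, mulVec_mulVec, mul_nonsing_inv _ hSDu, one_mulVec]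
  have hy : y = u + D *ᵥ t := by rw [hu]; abel
  have hz : z = S *ᵥ t - u := by
    rw [hu, eq_sub_iff_add_eq, ← sub_eq_iff_eq_add.mpr hw]; abel
  have hDy : D⁻¹ *ᵥ y = D⁻¹ *ᵥ u + t := by
    rw [hy, mulVec_add, mulVec_mulVec, nonsing_inv_mul _ hDu, one_mulVec]
  have hSz : S⁻¹ *ᵥ z = t - S⁻¹ *ᵥ u := by
    rw [hz, mulVec_sub, mulVec_mulVec, nonsing_inv_mul _ hSu, one_mulVec]
  have hsym : ∀ {C : Matrix ι ι ℝ}, C.PosDef → C.det ≠ 0 →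
      (C *ᵥ t) ⬝ᵥ C⁻¹ *ᵥ u = t ⬝ᵥ u := by
    intro C hC hdet
    have hCt : Cᵀ = C := by
      rw [← conjTranspose_eq_transpose_of_trivial]; exact hC.isHermitian
    rw [dotProduct_comm, dotProduct_mulVec, ← mulVec_transpose, hCt, mulVec_mulVec,
      mul_nonsing_inv _ hdet.isUnit, one_mulVec, dotProduct_comm]
  rw [hDy, hSz, hw]
  nth_rewrite 1 [hy]
  nth_rewrite 1 [hz]
  simp only [add_dotProduct, dotProduct_add, sub_dotProduct, dotProduct_sub, add_mulVec,
    hsym hS hS.det_pos.ne', hsym hD hD.det_pos.ne', dotProduct_comm u t]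
  ring

/-- The parallel sum of two positive definite matrices. -/
theorem mul_inv_add_mul_eq {ι : Type*} [Fintype ι] [DecidableEq ι] {S D : Matrix ι ι ℝ}
    (hS : S.PosDef) (hD : D.PosDef) : D * (S + D)⁻¹ * S = (D⁻¹ + S⁻¹)⁻¹ := by
  have hSu := (isUnit_iff_isUnit_det _).mp hS.isUnit
  have hDu := (isUnit_iff_isUnit_det _).mp hD.isUnit
  have h : D⁻¹ + S⁻¹ = S⁻¹ * (S + D) * D⁻¹ := by
    rw [mul_add, add_mul, nonsing_inv_mul _ hSu, one_mul, mul_assoc, mul_nonsing_inv _ hDu,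
      mul_one]
  rw [h, Matrix.mul_inv_rev, Matrix.mul_inv_rev, nonsing_inv_nonsing_inv _ hSu,
    nonsing_inv_nonsing_inv _ hDu, mul_assoc]

/-- The product of two Gaussian densities, as a marginal density times a conditional one. -/
theorem mvn_mul_mvn {d : ℕ} {S D C : Matrix (Fin d) (Fin d) ℝ} (hS : S.PosDef) (hD : D.PosDef)
    (hC : C = D * (S + D)⁻¹ * S) (y z : Fin d → ℝ) :
    mvn d D y * mvn d S z =
      mvn d (S + D) (y + z) * mvn d C (y - D *ᵥ ((S + D)⁻¹ *ᵥ (y + z))) := by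
  have hSD := hS.add hD
  have hCinv : C⁻¹ = D⁻¹ + S⁻¹ := by
    rw [hC, mul_inv_add_mul_eq hS hD, nonsing_inv_nonsing_inv _
      ((isUnit_iff_isUnit_det _).mp (hD.inv.add hS.inv).isUnit)]
  have hdet : C.det = D.det * S.det * (S + D).det⁻¹ := by
    rw [hC, det_mul, det_mul, det_nonsing_inv, Ring.inverse_eq_inv']
    ring
  have hdets : D.det ^ (-(1 : ℝ) / 2) * S.det ^ (-(1 : ℝ) / 2) =
      (S + D).det ^ (-(1 : ℝ) / 2) * C.det ^ (-(1 : ℝ) / 2) := by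
    have h1 := hS.det_pos
    have h2 := hD.det_pos
    have h3 := hSD.det_pos
    rw [← Real.mul_rpow h2.le h1.le, ← Real.mul_rpow h3.le (by rw [hdet]; positivity), hdet]
    congr 1
    field_simp
  have hexp : Real.exp (-(y ⬝ᵥ D⁻¹ *ᵥ y) / 2) * Real.exp (-(z ⬝ᵥ S⁻¹ *ᵥ z) / 2) =
      Real.exp (-((y + z) ⬝ᵥ (S + D)⁻¹ *ᵥ (y + z)) / 2) *
        Real.exp (-((y - D *ᵥ ((S + D)⁻¹ *ᵥ (y + z))) ⬝ᵥ
          C⁻¹ *ᵥ (y - D *ᵥ ((S + D)⁻¹ *ᵥ (y + z)))) / 2) := by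
    rw [← Real.exp_add, ← Real.exp_add, hCinv]
    congr 1
    linear_combination (-1 / 2) * dotProduct_inv_mulVec_add hS hD y z
  unfold mvn
  linear_combination ((2 * π) ^ (-(d : ℝ) / 2)) ^ 2 *
    (Real.exp (-(y ⬝ᵥ D⁻¹ *ᵥ y) / 2) * Real.exp (-(z ⬝ᵥ S⁻¹ *ᵥ z) / 2) * hdets +
      (S + D).det ^ (-(1 : ℝ) / 2) * C.det ^ (-(1 : ℝ) / 2) * hexp)

/-- Shifting the argument of a Gaussian density tilts it exponentially. -/
theorem mvn_sub_smul {d : ℕ} {C : Matrix (Fin d) (Fin d) ℝ} (hC : C.PosDef)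
    (z a : Fin d → ℝ) (v : ℝ) :
    mvn d C (z - v • a) =
      mvn d C z * Real.exp (-(a ⬝ᵥ C⁻¹ *ᵥ a) * v ^ 2 / 2 + (z ⬝ᵥ C⁻¹ *ᵥ a) * v) := by
  have hsym : a ⬝ᵥ C⁻¹ *ᵥ z = z ⬝ᵥ C⁻¹ *ᵥ a := by
    have hCt : C⁻¹ᵀ = C⁻¹ := by
      rw [← conjTranspose_eq_transpose_of_trivial]; exact hC.inv.isHermitian
    rw [dotProduct_mulVec, ← mulVec_transpose, hCt, dotProduct_comm]
  unfold mvn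
  rw [mul_assoc _ (Real.exp _) (Real.exp _), ← Real.exp_add]
  congr 2
  simp only [mulVec_sub, mulVec_smul, sub_dotProduct, dotProduct_sub, smul_dotProduct,
    dotProduct_smul, smul_eq_mul, hsym]
  ring

/-- A mixture of translates of a Gaussian density has the same mass as its mixing function. -/
theorem integral_integral_mvn_sub_mul {d : ℕ} {C : Matrix (Fin d) (Fin d) ℝ} (hC : C.PosDef)
    {m : ℝ → Fin d → ℝ} (hm : Continuous m) {h : ℝ → ℝ} (hh : Integrable h) :
    ∫ θ, ∫ v, mvn d C (θ - m v) * h v = ∫ v, h v := by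
  have hint : Integrable (mvn d C) :=
    .of_integral_ne_zero (by rw [integral_mvn_s8 hC]; exact one_ne_zero)
  have hmeas : AEStronglyMeasurable
      (Function.uncurry fun (θ : Fin d → ℝ) (v : ℝ) => mvn d C (θ - m v) * h v)
      (volume.prod volume) :=
    ((continuous_mvn_s8 d C).comp
      (continuous_fst.sub (hm.comp continuous_snd))).aestronglyMeasurable.mul
      hh.aestronglyMeasurable.comp_snd
  rw [integral_integral_swap]
  · refine integral_congr_ae (.of_forall fun v => ?_)
    dsimp only
    rw [integral_mul_const, integral_sub_right_eq_self (mvn d C), integral_mvn_s8 hC, one_mul]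
  · rw [integrable_prod_iff' hmeas]
    refine ⟨.of_forall fun v => (hint.comp_sub_right (m v)).mul_const (h v), ?_⟩
    refine hh.norm.congr (.of_forall fun v => ?_)
    simp only [Function.uncurry, norm_mul, Real.norm_of_nonneg (mvn_pos_s8 hC _).le]
    rw [integral_mul_const, integral_sub_right_eq_self (mvn d C), integral_mvn_s8 hC, one_mul]

/-- under a normal prior `N_d(μ, Δ)`, the posterior of an MMN model is
`MMN_d((I−P)x + Pμ, −(I−P)a, (I−P)Σ, L*)`, where `P = Σ(Σ+Δ)⁻¹` and `L*` has density
`g_{π,x}(v) ∝ g(v) e^{−Av²/2 + Bv}` with `A = aᵀ(Σ+Δ)⁻¹a`, `B = (x−μ)ᵀ(Σ+Δ)⁻¹a`. -/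
theorem mmn_posterior_representation
    (d : ℕ) (hd : 1 ≤ d) (a μ : Fin d → ℝ)
    (S D : Matrix (Fin d) (Fin d) ℝ) (hS : S.PosDef) (hD : D.PosDef)
    (g : ℝ → ℝ) (hgmeas : Measurable g) (hgpos : ∀ v, 0 ≤ g v)
    (hgnorm : ∫ v : ℝ, g v = 1)
    (x : Fin d → ℝ)
    (P : Matrix (Fin d) (Fin d) ℝ) (hP : P = S * (S + D)⁻¹)
    (A B : ℝ) (hA : A = a ⬝ᵥ (S + D)⁻¹ *ᵥ a) (hB : B = (x - μ) ⬝ᵥ (S + D)⁻¹ *ᵥ a)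
    (Ng : ℝ) (hNg : Ng = ∫ u : ℝ, g u * Real.exp (-A * u ^ 2 / 2 + B * u))
    (hNgInt : Integrable (fun u : ℝ => g u * Real.exp (-A * u ^ 2 / 2 + B * u)))
    (hNgpos : 0 < Ng)
    (gpix : ℝ → ℝ) (hgpix : gpix = fun v => g v * Real.exp (-A * v ^ 2 / 2 + B * v) / Ng)
    (px : (Fin d → ℝ) → ℝ)
    (hpx : px = fun θ => ∫ v : ℝ, mvn d S (x - θ - v • a) * g v)
    (post : (Fin d → ℝ) → ℝ)
    (hpost : post = fun θ =>
        mvn d D (θ - μ) * px θ / ∫ θ' : Fin d → ℝ, mvn d D (θ' - μ) * px θ') :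
    ∀ θ : Fin d → ℝ,
      post θ = ∫ v : ℝ,
        mvn d ((1 - P) * S) (θ - (1 - P) *ᵥ x - P *ᵥ μ + v • ((1 - P) *ᵥ a)) * gpix v := by
  have hSD := hS.add hD
  have hSDu := (isUnit_iff_isUnit_det _).mp hSD.isUnit
  have h1P : 1 - P = D * (S + D)⁻¹ := by
    rw [hP, sub_eq_iff_eq_add, ← add_mul, add_comm D S, mul_nonsing_inv _ hSDu]
  have hC : ((1 - P) * S).PosDef := by
    rw [h1P, mul_inv_add_mul_eq hS hD]
    exact (hD.inv.add hS.inv).inv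
  set C := (1 - P) * S with hCdef
  set K := mvn d (S + D) (x - μ) with hK
  have hKpos : 0 < K := mvn_pos_s8 hSD _
  set m : ℝ → Fin d → ℝ := fun v => (1 - P) *ᵥ x + P *ᵥ μ - v • ((1 - P) *ᵥ a) with hm
  set h : ℝ → ℝ := fun u => g u * Real.exp (-A * u ^ 2 / 2 + B * u) with hh
  have hprod : ∀ θ v, mvn d D (θ - μ) * (mvn d S (x - θ - v • a) * g v) =
      K * (mvn d C (θ - m v) * h v) := by
    intro θ v
    have hsum : (θ - μ) + (x - θ - v • a) = (x - μ) - v • a := by abel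
    have hcenter : (θ - μ) - D *ᵥ ((S + D)⁻¹ *ᵥ ((x - μ) - v • a)) = θ - m v := by
      rw [mulVec_mulVec, ← h1P, hm]
      simp only [mulVec_sub, mulVec_smul, sub_mulVec, one_mulVec, smul_sub]
      abel
    rw [← mul_assoc, mvn_mul_mvn hS hD (C := C) (by rw [hCdef, h1P]), hsum, hcenter,
      mvn_sub_smul hSD, ← hA, ← hB, hh]
    ring
  have hjoint : ∀ θ, mvn d D (θ - μ) * px θ = K * ∫ v, mvn d C (θ - m v) * h v := by
    intro θ
    rw [hpx]
    simp only [← integral_const_mul, hprod]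
  have hden : ∫ θ, mvn d D (θ - μ) * px θ = K * Ng := by
    simp only [hjoint]
    rw [integral_const_mul, integral_integral_mvn_sub_mul hC (by fun_prop) hNgInt, hNg]
  intro θ
  rw [hpost]
  simp only [hden]
  rw [hjoint, mul_div_mul_left _ _ hKpos.ne', ← integral_div, hgpix]
  refine integral_congr_ae (.of_forall fun v => ?_)
  have hθ : θ - (1 - P) *ᵥ x - P *ᵥ μ + v • ((1 - P) *ᵥ a) = θ - m v := by
    simp only [hm]; abel
  simp only [hθ, hh]
  ring
end

section
/- Let d ≥ 2, a ∈ ℝ^d with a ≠ 0, σ_X², σ_Y² > 0, L₁, L₂ probability measures on ℝ, H orthogonal with first row aᵀ/‖a‖ and remaining rows H₂, and π₀ : ℝ^{d−1} → [0,∞) measurable with marginals m_{π₀}(z, σ²) := ∫ φ_{d−1}(z − ζ; σ² I_{d−1}) π₀(ζ) dζ finite and positive for all z and the relevant σ². Let q̂_π(y; x) = ∫ q(y|θ)p(x|θ)π₀(H₂θ)dθ / ∫ p(x|θ)π₀(H₂θ)dθ be the Bayes predictive density and q̂_U(y; x) = ∫_{ℝ²} φ_d(y − x − (v₂ − v₁)a;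 (σ_X² + σ_Y²) I_d) dL₁dL₂ the MRE predictive density. Then for all x, y ∈ ℝ^d: q̂_π(y; x) = q̂_U(y; x) · m_{π₀}(H₂w, σ_W²) / m_{π₀}(H₂x, σ_X²), where w := (σ_X² y + σ_Y² x)/(σ_X² + σ_Y²) and σ_W² := σ_X²σ_Y²/(σ_X² + σ_Y²). -/
open MeasureTheory Matrix Real

open ProbabilityTheory

section IsotropicNormal

variable {d : ℕ} {s : ℝ}

theorem mvn_smul_one (hs : 0 < s) (z : Fin d → ℝ) :
    mvn d (s • (1 : Matrix (Fin d) (Fin d) ℝ)) z =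
      (√(2 * π * s))⁻¹ ^ d * Real.exp (-(z ⬝ᵥ z) / (2 * s)) := by
  have hdet : (s • (1 : Matrix (Fin d) (Fin d) ℝ)).det = s ^ d := by simp
  have hinv : (s • (1 : Matrix (Fin d) (Fin d) ℝ))⁻¹ = s⁻¹ • 1 := by
    apply Matrix.inv_eq_right_inv
    simp [smul_smul, hs.ne']
  have hpi : (0 : ℝ) < 2 * π := by positivity
  unfold mvn
  rw [hdet, hinv]
  congr 1
  · rw [← Real.rpow_natCast s d, ← Real.rpow_mul hs.le, Real.sqrt_eq_rpow,
      ← Real.rpow_neg (by positivity), ← Real.rpow_natCast, ← Real.rpow_mul (by positivity),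
      Real.mul_rpow hpi.le hs.le]
    congr 2 <;> ring
  · congr 1
    simp only [Matrix.smul_mulVec, Matrix.one_mulVec, dotProduct_smul, smul_eq_mul]
    field_simp

theorem mvn_smul_one_eq_prod (hs : 0 < s) (z : Fin d → ℝ) :
    mvn d (s • (1 : Matrix (Fin d) (Fin d) ℝ)) z =
      ∏ i, gaussianPDFReal 0 s.toNNReal (z i) := by
  simp only [mvn_smul_one hs, gaussianPDFReal, Real.coe_toNNReal s hs.le, sub_zero,
    Finset.prod_mul_distrib, Finset.prod_const, Finset.card_univ, Fintype.card_fin,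
    ← Real.exp_sum, ← Finset.sum_div, Finset.sum_neg_distrib, dotProduct, ← pow_two]

theorem continuous_mvn_smul_one (hs : 0 < s) :
    Continuous (mvn d (s • (1 : Matrix (Fin d) (Fin d) ℝ))) := by
  rw [funext (mvn_smul_one hs)]
  unfold dotProduct
  fun_prop

theorem mvn_smul_one_nonneg (hs : 0 < s) (z : Fin d → ℝ) :
    0 ≤ mvn d (s • (1 : Matrix (Fin d) (Fin d) ℝ)) z := by
  rw [mvn_smul_one hs]
  positivity

theorem mvn_smul_one_le (hs : 0 < s) (z : Fin d → ℝ) :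
    mvn d (s • (1 : Matrix (Fin d) (Fin d) ℝ)) z ≤ (√(2 * π * s))⁻¹ ^ d := by
  rw [mvn_smul_one hs]
  refine mul_le_of_le_one_right (by positivity) (Real.exp_le_one_iff.2 ?_)
  have : 0 ≤ z ⬝ᵥ z := Finset.sum_nonneg fun i _ => mul_self_nonneg (z i)
  rw [neg_div]
  exact neg_nonpos.2 (by positivity)

theorem gaussianPDFReal_mul_gaussianPDFReal {s t : ℝ} (hs : 0 < s) (ht : 0 < t) (x y θ : ℝ) :
    gaussianPDFReal 0 t.toNNReal (y - θ) * gaussianPDFReal 0 s.toNNReal (x - θ) =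
      gaussianPDFReal 0 (s + t).toNNReal (y - x) *
        gaussianPDFReal 0 (s * t / (s + t)).toNNReal ((s + t)⁻¹ * (s * y + t * x) - θ) := by
  have hst : 0 < s + t := by positivity
  have hw : 0 < s * t / (s + t) := by positivity
  simp only [gaussianPDFReal, Real.coe_toNNReal _ hs.le, Real.coe_toNNReal _ ht.le,
    Real.coe_toNNReal _ hst.le, Real.coe_toNNReal _ hw.le, sub_zero]
  rw [mul_mul_mul_comm, mul_mul_mul_comm (√(2 * π * (s + t)))⁻¹, ← Real.exp_add, ← Real.exp_add,
    ← mul_inv, ← mul_inv, ← Real.sqrt_mul (by positivity), ← Real.sqrt_mul (by positivity)]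
  refine congrArg₂ (· * ·) (congrArg (fun r => (√r)⁻¹) ?_) (congrArg Real.exp ?_)
  · field_simp
  · field_simp
    ring

theorem mvn_smul_one_mul_mvn_smul_one {s t : ℝ} (hs : 0 < s) (ht : 0 < t) (x y θ : Fin d → ℝ) :
    mvn d (t • (1 : Matrix (Fin d) (Fin d) ℝ)) (y - θ) *
        mvn d (s • (1 : Matrix (Fin d) (Fin d) ℝ)) (x - θ) =
      mvn d ((s + t) • (1 : Matrix (Fin d) (Fin d) ℝ)) (y - x) *
        mvn d ((s * t / (s + t)) • (1 : Matrix (Fin d) (Fin d) ℝ))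
          ((s + t)⁻¹ • (s • y + t • x) - θ) := by
  rw [mvn_smul_one_eq_prod hs, mvn_smul_one_eq_prod ht, mvn_smul_one_eq_prod (by positivity),
    mvn_smul_one_eq_prod (by positivity), ← Finset.prod_mul_distrib, ← Finset.prod_mul_distrib]
  exact Finset.prod_congr rfl fun i _ => gaussianPDFReal_mul_gaussianPDFReal hs ht _ _ _

theorem mvn_smul_one_mulVec (hs : 0 < s) {H : Matrix (Fin d) (Fin d) ℝ} (hH : H * Hᵀ = 1)
    (z : Fin d → ℝ) :
    mvn d (s • (1 : Matrix (Fin d) (Fin d) ℝ)) (H *ᵥ z) =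
      mvn d (s • (1 : Matrix (Fin d) (Fin d) ℝ)) z := by
  rw [mvn_smul_one hs, mvn_smul_one hs, Matrix.dotProduct_mulVec, Matrix.vecMul_mulVec,
    mul_eq_one_comm.1 hH, Matrix.vecMul_one]

theorem measurePreserving_mulVec_of_mul_transpose_eq_one {H : Matrix (Fin d) (Fin d) ℝ}
    (hH : H * Hᵀ = 1) : MeasurePreserving (fun θ : Fin d → ℝ => H *ᵥ θ) := by
  have hdet : |H.det| = 1 := by
    have h := congrArg Matrix.det hH
    rw [Matrix.det_mul, Matrix.det_transpose, Matrix.det_one] at h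
    rcases mul_self_eq_one_iff.1 h with h | h <;> simp [h]
  have h0 : H.det ≠ 0 := fun h => by simp [h] at hdet
  refine ⟨by fun_prop, ?_⟩
  have := Real.map_matrix_volume_pi_eq_smul_volume_pi h0
  rw [abs_inv, hdet, inv_one, ENNReal.ofReal_one, one_smul] at this
  exact this

theorem measurableEmbedding_mulVec_of_mul_transpose_eq_one {H : Matrix (Fin d) (Fin d) ℝ}
    (hH : H * Hᵀ = 1) : MeasurableEmbedding (fun θ : Fin d → ℝ => H *ᵥ θ) := by
  refine Measurable.measurableEmbedding (by fun_prop) fun x y hxy => ?_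
  simpa [mul_eq_one_comm.1 hH] using congrArg (Hᵀ *ᵥ ·) hxy

end IsotropicNormal

section Marginalization

variable {n : ℕ} {s : ℝ} {H : Matrix (Fin (n + 1)) (Fin (n + 1)) ℝ}
  {H₂ : Matrix (Fin n) (Fin (n + 1)) ℝ} {f : (Fin n → ℝ) → ℝ}

theorem mvn_smul_one_sub_mul_comp_mulVec (hs : 0 < s) (hH : H * Hᵀ = 1)
    (hH₂ : ∀ i j, H₂ i j = H i.succ j) (f : (Fin n → ℝ) → ℝ) (z θ : Fin (n + 1) → ℝ) :
    mvn (n + 1) (s • (1 : Matrix (Fin (n + 1)) (Fin (n + 1)) ℝ)) (z - θ) * f (H₂ *ᵥ θ) =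
      gaussianPDFReal ((H *ᵥ z) 0) s.toNNReal ((H *ᵥ θ) 0) *
        (mvn n (s • (1 : Matrix (Fin n) (Fin n) ℝ)) (H₂ *ᵥ z - Fin.tail (H *ᵥ θ)) *
          f (Fin.tail (H *ᵥ θ))) := by
  have htail (u : Fin (n + 1) → ℝ) : H₂ *ᵥ u = Fin.tail (H *ᵥ u) := by
    ext i
    simp [Matrix.mulVec, dotProduct, hH₂, Fin.tail]
  have hswap : gaussianPDFReal ((H *ᵥ z) 0) s.toNNReal ((H *ᵥ θ) 0) =
      gaussianPDFReal 0 s.toNNReal ((H *ᵥ z) 0 - (H *ᵥ θ) 0) := by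
    simp only [gaussianPDFReal, sub_zero]
    rw [sub_sq_comm]
  rw [← mvn_smul_one_mulVec hs hH, Matrix.mulVec_sub, mvn_smul_one_eq_prod hs,
    Fin.prod_univ_succ, mvn_smul_one_eq_prod hs, hswap, htail, htail, ← mul_assoc]
  rfl

theorem integrable_mvn_sub_mul_comp_mulVec (hs : 0 < s) (hH : H * Hᵀ = 1)
    (hH₂ : ∀ i j, H₂ i j = H i.succ j) (z : Fin (n + 1) → ℝ)
    (hf : Integrable fun ζ : Fin n → ℝ =>
      mvn n (s • (1 : Matrix (Fin n) (Fin n) ℝ)) (H₂ *ᵥ z - ζ) * f ζ) :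
    Integrable fun θ : Fin (n + 1) → ℝ =>
      mvn (n + 1) (s • (1 : Matrix (Fin (n + 1)) (Fin (n + 1)) ℝ)) (z - θ) * f (H₂ *ᵥ θ) := by
  simp only [mvn_smul_one_sub_mul_comp_mulVec hs hH hH₂]
  have hg := (integrable_gaussianPDFReal ((H *ᵥ z) 0) s.toNNReal).mul_prod hf
  have hg' := (volume_preserving_piFinSuccAbove
    (fun _ : Fin (n + 1) => ℝ) 0).integrable_comp_of_integrable hg
  exact (measurePreserving_mulVec_of_mul_transpose_eq_one hH).integrable_comp_of_integrable hg'

theorem integral_mvn_sub_mul_comp_mulVec (hs : 0 < s) (hH : H * Hᵀ = 1)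
    (hH₂ : ∀ i j, H₂ i j = H i.succ j) (f : (Fin n → ℝ) → ℝ) (z : Fin (n + 1) → ℝ) :
    ∫ θ : Fin (n + 1) → ℝ,
      mvn (n + 1) (s • (1 : Matrix (Fin (n + 1)) (Fin (n + 1)) ℝ)) (z - θ) * f (H₂ *ᵥ θ) =
    ∫ ζ : Fin n → ℝ, mvn n (s • (1 : Matrix (Fin n) (Fin n) ℝ)) (H₂ *ᵥ z - ζ) * f ζ := by
  simp only [mvn_smul_one_sub_mul_comp_mulVec hs hH hH₂]
  have h₁ := (measurePreserving_mulVec_of_mul_transpose_eq_one hH).integral_comp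
    (measurableEmbedding_mulVec_of_mul_transpose_eq_one hH)
    (fun η : Fin (n + 1) → ℝ => gaussianPDFReal ((H *ᵥ z) 0) s.toNNReal (η 0) *
      (mvn n (s • (1 : Matrix (Fin n) (Fin n) ℝ)) (H₂ *ᵥ z - Fin.tail η) * f (Fin.tail η)))
  have h₂ := (volume_preserving_piFinSuccAbove (fun _ : Fin (n + 1) => ℝ) 0).integral_comp'
    (fun η : ℝ × (Fin n → ℝ) => gaussianPDFReal ((H *ᵥ z) 0) s.toNNReal η.1 *
      (mvn n (s • (1 : Matrix (Fin n) (Fin n) ℝ)) (H₂ *ᵥ z - η.2) * f η.2))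
  refine h₁.trans (h₂.trans ?_)
  rw [Measure.volume_eq_prod, integral_prod_mul (gaussianPDFReal ((H *ᵥ z) 0) s.toNNReal)
    (fun ζ => mvn n (s • (1 : Matrix (Fin n) (Fin n) ℝ)) (H₂ *ᵥ z - ζ) * f ζ),
    integral_gaussianPDFReal_eq_one _ (by simpa using hs), one_mul]

/-- Mixing a Gaussian kernel over centres with a common image under `H₂` does not change the
marginal of a function of `H₂ *ᵥ θ`. -/
theorem integral_integral_mul_mvn_sub_mul_comp_mulVec {Ω : Type*} [MeasurableSpace Ω]
    (μ : Measure Ω) [IsProbabilityMeasure μ] (hs : 0 < s) (hH : H * Hᵀ = 1)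
    (hH₂ : ∀ i j, H₂ i j = H i.succ j) (hfm : Measurable f) (hf0 : ∀ ζ, 0 ≤ f ζ)
    {z : Ω → Fin (n + 1) → ℝ} (hz : Measurable z) {ζ₀ : Fin n → ℝ} (hζ₀ : ∀ ω, H₂ *ᵥ z ω = ζ₀)
    {c : Ω → ℝ} (hc : Integrable c μ)
    (hf : Integrable fun ζ : Fin n → ℝ =>
      mvn n (s • (1 : Matrix (Fin n) (Fin n) ℝ)) (ζ₀ - ζ) * f ζ) :
    ∫ θ : Fin (n + 1) → ℝ, ∫ ω, c ω *
      (mvn (n + 1) (s • (1 : Matrix (Fin (n + 1)) (Fin (n + 1)) ℝ)) (z ω - θ) *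
        f (H₂ *ᵥ θ)) ∂μ =
    (∫ ω, c ω ∂μ) *
      ∫ ζ : Fin n → ℝ, mvn n (s • (1 : Matrix (Fin n) (Fin n) ℝ)) (ζ₀ - ζ) * f ζ := by
  have hint (ω : Ω) := integral_mvn_sub_mul_comp_mulVec hs hH hH₂ f (z ω)
  have hnonneg (ω : Ω) (θ : Fin (n + 1) → ℝ) : 0 ≤
      mvn (n + 1) (s • (1 : Matrix (Fin (n + 1)) (Fin (n + 1)) ℝ)) (z ω - θ) * f (H₂ *ᵥ θ) :=
    mul_nonneg (mvn_smul_one_nonneg hs _) (hf0 _)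
  have hmeas : Measurable fun r : Ω × (Fin (n + 1) → ℝ) =>
      mvn (n + 1) (s • (1 : Matrix (Fin (n + 1)) (Fin (n + 1)) ℝ)) (z r.1 - r.2) *
        f (H₂ *ᵥ r.2) := by
    refine ((continuous_mvn_smul_one hs).measurable.comp
      ((hz.comp measurable_fst).sub measurable_snd)).mul (hfm.comp ?_)
    exact Measurable.comp (g := fun θ : Fin (n + 1) → ℝ => H₂ *ᵥ θ) (by fun_prop) measurable_snd
  rw [← integral_integral_swap]
  · simp only [integral_const_mul, hint, hζ₀, integral_mul_const]
  · refine (integrable_prod_iff ?_).2 ⟨?_, ?_⟩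
    · exact hc.aestronglyMeasurable.comp_fst.mul hmeas.aestronglyMeasurable
    · exact .of_forall fun ω => (integrable_mvn_sub_mul_comp_mulVec hs hH hH₂ (z ω)
        (by rwa [hζ₀ ω])).const_mul (c ω)
    · simp only [Function.uncurry, norm_mul (c _), Real.norm_of_nonneg (hnonneg _ _),
        integral_const_mul, hint, hζ₀]
      exact hc.norm.mul_const _

end Marginalization

/-- representation of the Bayes predictive density for the prior
`π(θ) = π₀(H₂θ)` in terms of the MRE density:
`q̂_π(y; x) = q̂_U(y; x) · m_{π₀}(H₂w, σ_W²)/m_{π₀}(H₂x, σ_X²)` with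
`w = (σ_X²y + σ_Y²x)/(σ_X² + σ_Y²)` and `σ_W² = σ_X²σ_Y²/(σ_X² + σ_Y²)` (`d = n + 1 ≥ 2`). -/
theorem bayes_predictive_mre_representation
    (n : ℕ) (hd : 2 ≤ n + 1) (a : Fin (n + 1) → ℝ) (ha : a ≠ 0)
    (sX2 sY2 sS2 sW2 : ℝ) (hX : 0 < sX2) (hY : 0 < sY2) (hS : sS2 = sX2 + sY2)
    (hW : sW2 = sX2 * sY2 / (sX2 + sY2))
    (L₁ L₂ : Measure ℝ) [IsProbabilityMeasure L₁] [IsProbabilityMeasure L₂]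
    (p q : (Fin (n + 1) → ℝ) → (Fin (n + 1) → ℝ) → ℝ)
    (hp : p = fun x θ => ∫ v₁,
        mvn (n + 1) (sX2 • (1 : Matrix (Fin (n + 1)) (Fin (n + 1)) ℝ)) (x - θ - v₁ • a) ∂L₁)
    (hq : q = fun y θ => ∫ v₂,
        mvn (n + 1) (sY2 • (1 : Matrix (Fin (n + 1)) (Fin (n + 1)) ℝ)) (y - θ - v₂ • a) ∂L₂)
    (H : Matrix (Fin (n + 1)) (Fin (n + 1)) ℝ) (hH : H * Hᵀ = 1)
    (hrow : ∀ j, H 0 j = a j / Real.sqrt (a ⬝ᵥ a))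
    (H₂ : Matrix (Fin n) (Fin (n + 1)) ℝ) (hH₂ : ∀ i j, H₂ i j = H i.succ j)
    (π₀ : (Fin n → ℝ) → ℝ) (hπ₀meas : Measurable π₀) (hπ₀pos : ∀ ζ, 0 ≤ π₀ ζ)
    (m : (Fin n → ℝ) → ℝ → ℝ)
    (hm : m = fun z σ2 =>
        ∫ ζ : Fin n → ℝ, mvn n (σ2 • (1 : Matrix (Fin n) (Fin n) ℝ)) (z - ζ) * π₀ ζ)
    (hmargX : ∀ z : Fin n → ℝ,
        Integrable (fun ζ : Fin n → ℝ =>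
          mvn n (sX2 • (1 : Matrix (Fin n) (Fin n) ℝ)) (z - ζ) * π₀ ζ))
    (hmargXpos : ∀ z : Fin n → ℝ, 0 < m z sX2)
    (hmargW : ∀ z : Fin n → ℝ,
        Integrable (fun ζ : Fin n → ℝ =>
          mvn n (sW2 • (1 : Matrix (Fin n) (Fin n) ℝ)) (z - ζ) * π₀ ζ))
    (hmargWpos : ∀ z : Fin n → ℝ, 0 < m z sW2)
    (qπ : (Fin (n + 1) → ℝ) → (Fin (n + 1) → ℝ) → ℝ)
    (hqπ : qπ = fun y x =>
        (∫ θ : Fin (n + 1) → ℝ, q y θ * p x θ * π₀ (H₂ *ᵥ θ)) /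
          (∫ θ : Fin (n + 1) → ℝ, p x θ * π₀ (H₂ *ᵥ θ)))
    (qU : (Fin (n + 1) → ℝ) → (Fin (n + 1) → ℝ) → ℝ)
    (hqU : qU = fun y x => ∫ v₁, ∫ v₂,
        mvn (n + 1) (sS2 • (1 : Matrix (Fin (n + 1)) (Fin (n + 1)) ℝ))
          (y - x - (v₂ - v₁) • a) ∂L₂ ∂L₁) :
    ∀ x y : Fin (n + 1) → ℝ,
      qπ y x = qU y x *
          m (H₂ *ᵥ ((sX2 + sY2)⁻¹ • (sX2 • y + sY2 • x))) sW2 / m (H₂ *ᵥ x) sX2 := by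

  intro x y
  have hS0 : 0 < sX2 + sY2 := by positivity
  have hW0 : 0 < sX2 * sY2 / (sX2 + sY2) := by positivity
  subst hS hW hp hq hqπ hqU hm
  have hH₂a : H₂ *ᵥ a = 0 := by
    have haa : √(a ⬝ᵥ a) ≠ 0 := by
      have hnn : 0 ≤ a ⬝ᵥ a := Finset.sum_nonneg fun i _ => mul_self_nonneg (a i)
      rw [Real.sqrt_ne_zero hnn]
      simpa using ha
    ext i
    have h : (H * Hᵀ) i.succ 0 = 0 := by simp [hH]
    simp only [Matrix.mul_apply, Matrix.transpose_apply, hrow, ← mul_div_assoc,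
      ← Finset.sum_div, div_eq_zero_iff, haa, or_false] at h
    simpa [Matrix.mulVec, dotProduct, hH₂] using h
  have hden : ∫ θ : Fin (n + 1) → ℝ, (∫ v₁,
      mvn (n + 1) (sX2 • (1 : Matrix (Fin (n + 1)) (Fin (n + 1)) ℝ)) (x - θ - v₁ • a) ∂L₁) *
        π₀ (H₂ *ᵥ θ) =
      ∫ ζ : Fin n → ℝ, mvn n (sX2 • (1 : Matrix (Fin n) (Fin n) ℝ)) (H₂ *ᵥ x - ζ) * π₀ ζ := by
    have h := integral_integral_mul_mvn_sub_mul_comp_mulVec L₁ hX hH hH₂ hπ₀meas hπ₀pos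
      (z := fun v => x - v • a) (by fun_prop) (ζ₀ := H₂ *ᵥ x)
      (fun v => by simp [Matrix.mulVec_sub, Matrix.mulVec_smul, hH₂a])
      (integrable_const (1 : ℝ)) (hmargX _)
    simpa only [one_mul, integral_const, probReal_univ, smul_eq_mul, integral_mul_const,
      sub_right_comm x _ (_ • a)] using h
  have hc : Integrable (fun v : ℝ × ℝ =>
      mvn (n + 1) ((sX2 + sY2) • (1 : Matrix (Fin (n + 1)) (Fin (n + 1)) ℝ))
        (y - x - (v.2 - v.1) • a)) (L₁.prod L₂) := by
    refine Integrable.of_bound (C := (√(2 * π * (sX2 + sY2)))⁻¹ ^ (n + 1)) ?_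
      (.of_forall fun v => ?_)
    · exact ((continuous_mvn_smul_one hS0).comp (by fun_prop)).aestronglyMeasurable
    · rw [Real.norm_of_nonneg (mvn_smul_one_nonneg hS0 _)]
      exact mvn_smul_one_le hS0 _
  have hnum : ∫ θ : Fin (n + 1) → ℝ,
      (∫ v₂, mvn (n + 1) (sY2 • (1 : Matrix (Fin (n + 1)) (Fin (n + 1)) ℝ))
        (y - θ - v₂ • a) ∂L₂) *
      (∫ v₁, mvn (n + 1) (sX2 • (1 : Matrix (Fin (n + 1)) (Fin (n + 1)) ℝ))
        (x - θ - v₁ • a) ∂L₁) * π₀ (H₂ *ᵥ θ) =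
      (∫ v₁, ∫ v₂, mvn (n + 1) ((sX2 + sY2) • (1 : Matrix (Fin (n + 1)) (Fin (n + 1)) ℝ))
        (y - x - (v₂ - v₁) • a) ∂L₂ ∂L₁) *
      ∫ ζ : Fin n → ℝ, mvn n ((sX2 * sY2 / (sX2 + sY2)) • (1 : Matrix (Fin n) (Fin n) ℝ))
        (H₂ *ᵥ ((sX2 + sY2)⁻¹ • (sX2 • y + sY2 • x)) - ζ) * π₀ ζ := by
    have h := integral_integral_mul_mvn_sub_mul_comp_mulVec (L₁.prod L₂) hW0 hH hH₂ hπ₀meas hπ₀pos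
      (z := fun v => (sX2 + sY2)⁻¹ • (sX2 • (y - v.2 • a) + sY2 • (x - v.1 • a))) (by fun_prop)
      (ζ₀ := H₂ *ᵥ ((sX2 + sY2)⁻¹ • (sX2 • y + sY2 • x)))
      (fun v => by simp [Matrix.mulVec_sub, Matrix.mulVec_add, Matrix.mulVec_smul, hH₂a])
      hc (hmargW _)
    rw [integral_prod _ hc] at h
    rw [← h]
    refine integral_congr_ae (.of_forall fun θ => ?_)
    simp only [← mul_assoc]
    rw [integral_mul_const, mul_comm (∫ v₂, _ ∂L₂), ← integral_prod_mul]
    congr 1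
    refine integral_congr_ae (.of_forall fun v => ?_)
    have hprod := mvn_smul_one_mul_mvn_smul_one hX hY (x - v.1 • a) (y - v.2 • a) θ
    have hdiff : y - v.2 • a - (x - v.1 • a) = y - x - (v.2 - v.1) • a := by
      rw [sub_smul]
      abel
    rw [hdiff] at hprod
    simp only [← hprod, sub_right_comm _ θ]
    exact mul_comm _ _
  simp only [hnum, hden]
end
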